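/- For every Θ = (θ₁,…,θ_n) ∈ ℝⁿ \ ℚⁿ with n ≥ 2, the uniform exponents satisfy ω̂(L_Θ) ≥ (n-1)/(1 - ω̂(Θ)), where ω̂(Θ) is the uniform simultaneous exponent and ω̂(L_Θ) is the uniform exponent of the linear form L_Θ(x,y) = θ₁x₁ + … + θ_n x_n - y (with the convention that the right-hand side is +∞ when ω̂(Θ) = 1). -/

import Mathlib

open Matrix in
/-- Minkowski's theorem on linear forms, with strict inequalities. -/
theorem exists_int_forms_lt {ι : Type*} [Fintype ι] [DecidableEq ι] (M : Matrix ι ι ℝ)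
    (hM : M.det ≠ 0) (r : ι → ℝ) (hr : ∀ i, 0 < r i) (h : |M.det| < ∏ i, r i) :
    ∃ w : ι → ℤ, w ≠ 0 ∧ ∀ i, |(M *ᵥ fun k => (w k : ℝ)) i| < r i := by
  set box : Set (ι → ℝ) := Set.univ.pi fun i => Set.Ioo (-r i) (r i) with hbox
  set s : Set (ι → ℝ) := Matrix.toLin' M ⁻¹' box with hs
  have hmem (x : ι → ℝ) : x ∈ s ↔ ∀ i, |(M *ᵥ x) i| < r i := by
    simp [hs, hbox, abs_lt]
  have hconv : Convex ℝ s :=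
    (convex_pi fun i _ => convex_Ioo _ _).linear_preimage _
  have hsymm : ∀ x ∈ s, -x ∈ s := fun x hx => by
    rw [hmem] at hx ⊢
    simpa [Matrix.mulVec_neg] using hx
  let b := Pi.basisFun ℝ ι
  have hprod : 0 < |M.det| := abs_pos.2 hM
  have hvol : MeasureTheory.volume s =
      ENNReal.ofReal (|M.det|⁻¹ * ((∏ i, r i) * 2 ^ Fintype.card ι)) := by
    rw [hs, MeasureTheory.Measure.addHaar_preimage_linearMap _ (by simpa using hM), hbox,
      Real.volume_pi_Ioo, ← ENNReal.ofReal_prod_of_nonneg (fun i _ => by linarith [hr i]),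
      ← ENNReal.ofReal_mul (by positivity), LinearMap.det_toLin', abs_inv]
    congr 2
    rw [← Finset.card_univ, ← Finset.prod_const, ← Finset.prod_mul_distrib]
    exact Finset.prod_congr rfl fun i _ => by ring
  have hlt : MeasureTheory.volume (ZSpan.fundamentalDomain b) * 2 ^ Module.finrank ℝ (ι → ℝ) <
      MeasureTheory.volume s := by
    rw [hvol, ZSpan.fundamentalDomain_pi_basisFun, MeasureTheory.volume_pi_pi]
    simp only [Real.volume_Ico, sub_zero, ENNReal.ofReal_one, Finset.prod_const_one, one_mul,
      Module.finrank_fintype_fun_eq_card]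
    rw [← ENNReal.ofReal_ofNat, ← ENNReal.ofReal_pow (by norm_num)]
    refine (ENNReal.ofReal_lt_ofReal_iff_of_nonneg (by positivity)).2 ?_
    rw [← mul_assoc]
    refine lt_mul_of_one_lt_left (by positivity) ?_
    rwa [inv_mul_eq_div, one_lt_div hprod]
  have : Countable (Submodule.span ℤ (Set.range b)).toAddSubgroup :=
    inferInstanceAs (Countable (Submodule.span ℤ (Set.range b)))
  obtain ⟨⟨x, hx⟩, hx0, hxs⟩ :=
    MeasureTheory.exists_ne_zero_mem_lattice_of_measure_mul_two_pow_lt_measure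
      (ZSpan.isAddFundamentalDomain' b MeasureTheory.volume) hsymm hconv hlt
  choose w hw using (b.mem_span_iff_repr_mem ℤ x).1 hx
  have hwx : (fun k => (w k : ℝ)) = x := funext fun k => by simpa [b] using hw k
  refine ⟨w, ?_, by rw [hwx]; exact (hmem x).1 hxs⟩
  rintro rfl
  apply hx0
  ext k
  simp [← hwx]

theorem det_updateRow_updateRow_one {ι : Type*} [Fintype ι] [DecidableEq ι] {k j : ι}
    (hkj : k ≠ j) (a b : ι → ℝ) :
    (((1 : Matrix ι ι ℝ).updateRow k a).updateRow j b).det = a k * b j - a j * b k := by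
  let U : Matrix ι (Fin 2) ℝ := Matrix.of fun i => ![if i = k then 1 else 0, if i = j then 1 else 0]
  let V : Matrix (Fin 2) ι ℝ := Matrix.of ![a - Pi.single k 1, b - Pi.single j 1]
  have h : ((1 : Matrix ι ι ℝ).updateRow k a).updateRow j b = 1 + U * V := by
    ext i l
    rcases eq_or_ne i j with rfl | hij
    · simp [U, V, Matrix.mul_apply, hkj.symm, Matrix.one_apply, Pi.single_apply, eq_comm (b := l)]
    · rcases eq_or_ne i k with rfl | hik
      · simp [U, V, Matrix.mul_apply, hij, Matrix.one_apply, Pi.single_apply, eq_comm (b := l)]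
      · simp [U, V, Matrix.mul_apply, hij, hik]
  rw [h, Matrix.det_one_add_mul_comm, Matrix.det_fin_two]
  simp only [Matrix.add_apply, Matrix.mul_apply]
  simp [U, V, hkj, hkj.symm]

/-- Minkowski's theorem for two arbitrary linear forms and coordinate forms. -/
theorem exists_int_two_forms_lt {ι : Type*} [Fintype ι] [DecidableEq ι] {k j : ι} (hkj : k ≠ j)
    (a b : ι → ℝ) (hab : a k * b j - a j * b k ≠ 0) {A B S : ℝ} (hA : 0 < A) (hB : 0 < B)
    (hS : 0 < S) (h : |a k * b j - a j * b k| < A * B * S ^ (Fintype.card ι - 2)) :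
    ∃ w : ι → ℤ, w ≠ 0 ∧ |∑ i, a i * w i| < A ∧ |∑ i, b i * w i| < B ∧
      ∀ i, i ≠ k → i ≠ j → |(w i : ℝ)| < S := by
  rw [← det_updateRow_updateRow_one hkj] at hab h
  have hprod : A * B * S ^ (Fintype.card ι - 2) =
      ∏ i, if i = j then B else if i = k then A else S := by
    rw [← Finset.mul_prod_erase _ _ (Finset.mem_univ j),
      ← Finset.mul_prod_erase _ _ (Finset.mem_erase.2 ⟨hkj, Finset.mem_univ k⟩),
      Finset.prod_congr rfl (g := fun _ => S) fun i hi => by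
        simp only [Finset.mem_erase] at hi
        simp [hi.1, hi.2.1],
      Finset.prod_const, Finset.card_erase_of_mem (by simpa using hkj),
      Finset.card_erase_of_mem (Finset.mem_univ j), Finset.card_univ, Nat.sub_sub]
    simp only [if_true, if_neg hkj]
    ring
  obtain ⟨w, hw0, hw⟩ := exists_int_forms_lt _ hab
    (fun i => if i = j then B else if i = k then A else S)
    (fun i => by split_ifs <;> assumption) (h.trans_eq hprod)
  refine ⟨w, hw0, ?_, ?_, fun i hik hij => ?_⟩
  · simpa [Matrix.mulVec, dotProduct, hkj] using hw k
  · simpa [Matrix.mulVec, dotProduct] using hw j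
  · simpa [Matrix.mulVec, dotProduct, hik, hij, Matrix.one_apply] using hw i

theorem abs_mul_le_of_abs_sum_le {n : ℕ} {c w : Fin n → ℝ} {j : Fin n} {R S : ℝ} (hS : 0 ≤ S)
    (hc : ∀ i, |c i| ≤ |c j|) (hw : ∀ i, i ≠ j → |w i| ≤ S) (h : |∑ i, c i * w i| ≤ R) :
    |w j| * |c j| ≤ R + n * S * |c j| := by
  have hsum := Finset.add_sum_erase Finset.univ (fun i => c i * w i) (Finset.mem_univ j)
  have hrest : |∑ i ∈ Finset.univ.erase j, c i * w i| ≤ n * S * |c j| := by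
    calc |∑ i ∈ Finset.univ.erase j, c i * w i|
        ≤ ∑ i ∈ Finset.univ.erase j, |c i * w i| := Finset.abs_sum_le_sum_abs _ _
      _ ≤ ∑ i ∈ Finset.univ.erase j, |c j| * S := Finset.sum_le_sum fun i hi => by
          rw [abs_mul]
          exact mul_le_mul (hc i) (hw i (Finset.ne_of_mem_erase hi)) (abs_nonneg _) (abs_nonneg _)
      _ ≤ ∑ _i : Fin n, |c j| * S :=
          Finset.sum_le_sum_of_subset_of_nonneg (Finset.erase_subset _ _) fun _ _ _ => by positivity
      _ = n * S * |c j| := by simp; ring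
  have hj : c j * w j = ∑ i, c i * w i - ∑ i ∈ Finset.univ.erase j, c i * w i := by
    rw [← hsum]; ring
  rw [mul_comm, ← abs_mul, hj]
  exact (abs_sub _ _).trans (add_le_add h hrest)

/-- The integer points orthogonal to an approximation `(q, y)` see the linear form through the
errors `θ i * q - y i` only. -/
theorem mul_form_eq_sum_error {n : ℕ} (θ : Fin n → ℝ) (q : ℤ) (y : Fin n → ℤ) (w₀ : ℤ)
    (w : Fin n → ℤ) (h : -(q : ℝ) * w₀ + ∑ i, (y i : ℝ) * w i = 0) :
    (q : ℝ) * (∑ i, θ i * w i - w₀) = ∑ i, (θ i * q - y i) * w i := by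
  simp only [sub_mul, Finset.sum_sub_distrib]
  rw [mul_sub, Finset.mul_sum, Finset.sum_congr rfl fun i _ => mul_left_comm _ _ _]
  simp only [mul_assoc] at h ⊢
  linarith

theorem exists_int_two_forms_lt_of_fin {n : ℕ} (j : Fin n) (a₀ b₀ : ℝ) (a b : Fin n → ℝ)
    (hab : a₀ * b j - a j * b₀ ≠ 0) {A B S : ℝ} (hA : 0 < A) (hB : 0 < B) (hS : 0 < S)
    (h : |a₀ * b j - a j * b₀| < A * B * S ^ (n - 1)) :
    ∃ (w₀ : ℤ) (w : Fin n → ℤ), (w = 0 → w₀ ≠ 0) ∧ |a₀ * w₀ + ∑ i, a i * w i| < A ∧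
      |b₀ * w₀ + ∑ i, b i * w i| < B ∧ ∀ i, i ≠ j → |(w i : ℝ)| < S := by
  obtain ⟨w, hw0, hwa, hwb, hwi⟩ := exists_int_two_forms_lt (k := none) (j := some j) (by simp)
    (fun o => o.elim a₀ a) (fun o => o.elim b₀ b) hab hA hB hS (by simpa using h)
  refine ⟨w none, fun i => w (some i), fun h1 h2 => hw0 ?_, by simpa [Fintype.sum_option] using hwa,
    by simpa [Fintype.sum_option] using hwb, fun i hi => hwi _ (by simp) (by simpa using hi)⟩
  ext o
  cases o with
  | none => exact h2
  | some i => exact congrFun h1 i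

theorem intCast_form_eq_zero {n : ℕ} {q w₀ : ℤ} {y w : Fin n → ℤ}
    (h : |-(q : ℝ) * w₀ + ∑ i, (y i : ℝ) * w i| < 1) :
    -(q : ℝ) * w₀ + ∑ i, (y i : ℝ) * w i = 0 := by
  have h' : |-q * w₀ + ∑ i, y i * w i| < 1 := by exact_mod_cast h
  exact_mod_cast Int.abs_lt_one_iff.1 h'

theorem exists_small_form_of_large_error {n : ℕ} (θ : Fin n → ℝ) {q : ℤ} (hq : 0 < q)
    (y : Fin n → ℤ) {j : Fin n} (hj : ∀ i, |θ i * q - y i| ≤ |θ j * q - y j|) {S t : ℝ}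
    (hS : 0 < S) (ht : 0 < t) (herr : |θ j * q - y j| < t⁻¹ * S ^ (n - 1))
    (hlarge : q < n ^ 2 * S * |θ j * q - y j| * t) :
    ∃ (w₀ : ℤ) (w : Fin n → ℤ), (w = 0 → w₀ ≠ 0) ∧ (∀ i, |(w i : ℝ)| ≤ 2 * n ^ 2 * S) ∧
      |∑ i, θ i * w i - w₀| ≤ t⁻¹ := by
  have hq' : (0 : ℝ) < q := by exact_mod_cast hq
  have hn : (1 : ℝ) ≤ n := by exact_mod_cast j.pos
  have hE : 0 < |θ j * q - y j| := by
    by_contra! hE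
    rw [le_antisymm hE (abs_nonneg _)] at hlarge
    linarith
  have hdet : (-1 : ℝ) * y j - θ j * (-q) = θ j * q - y j := by ring
  obtain ⟨w₀, w, hw, hL, hv, hwi⟩ := exists_int_two_forms_lt_of_fin j (-1) (-q) θ (fun i => y i)
    (by rw [hdet]; exact abs_pos.1 hE) (inv_pos.2 ht) one_pos hS
    (by rw [hdet, mul_one]; exact herr)
  have hL' : |∑ i, θ i * w i - w₀| < t⁻¹ := by
    convert hL using 2; ring
  refine ⟨w₀, w, hw, fun i => ?_, hL'.le⟩
  rcases eq_or_ne i j with rfl | hi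
  · have hR : |∑ l, (θ l * q - y l) * w l| ≤ n ^ 2 * S * |θ i * q - y i| := by
      rw [← mul_form_eq_sum_error θ q y w₀ w (intCast_form_eq_zero hv), abs_mul, abs_of_pos hq']
      calc (q : ℝ) * |∑ i, θ i * w i - w₀| ≤ (n ^ 2 * S * |θ i * q - y i| * t) * t⁻¹ :=
            mul_le_mul hlarge.le hL'.le (abs_nonneg _) (by positivity)
        _ = _ := by field_simp
    have h := abs_mul_le_of_abs_sum_le hS.le hj (fun l hl => (hwi l hl).le) hR
    refine le_of_mul_le_mul_right (h.trans ?_) hE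
    have : (n : ℝ) * S * |θ i * q - y i| ≤ n ^ 2 * S * |θ i * q - y i| := by
      gcongr; nlinarith
    linarith
  · refine (hwi i hi).le.trans (le_mul_of_one_le_left hS.le ?_)
    nlinarith

theorem exists_small_form_of_small_error {n : ℕ} (θ : Fin n → ℝ) {p q : ℤ} (hq : 0 < q)
    (y z : Fin n → ℤ) {j : Fin n}
    (hj : ∀ i, |(p : ℝ) * y i - q * z i| ≤ |(p : ℝ) * y j - q * z j|)
    (hj0 : (p : ℝ) * y j - q * z j ≠ 0) {S t E : ℝ} (hS : 0 < S) (ht : 0 < t)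
    (hE : ∀ i, |θ i * q - y i| ≤ E)
    (hminor : |(p : ℝ) * y j - q * z j| < S ^ (n - 1)) (hsmall : n ^ 2 * S * E * t ≤ q) :
    ∃ (w₀ : ℤ) (w : Fin n → ℤ), (w = 0 → w₀ ≠ 0) ∧ (∀ i, |(w i : ℝ)| ≤ 2 * n ^ 2 * S) ∧
      |∑ i, θ i * w i - w₀| ≤ t⁻¹ := by
  have hq' : (0 : ℝ) < q := by exact_mod_cast hq
  have hn : (1 : ℝ) ≤ n := by exact_mod_cast j.pos
  have hdet : (-p : ℝ) * y j - z j * (-q) = -(p * y j - q * z j) := by ring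
  obtain ⟨w₀, w, hw, hu, hv, hwi⟩ := exists_int_two_forms_lt_of_fin j (-p) (-q) (fun i => z i)
    (fun i => y i) (by rw [hdet]; exact neg_ne_zero.2 hj0) one_pos one_pos hS
    (by rw [hdet, abs_neg]; simpa using hminor)
  have hu0 := intCast_form_eq_zero hu
  have hv0 := intCast_form_eq_zero hv
  have hsum : ∑ i, ((p : ℝ) * y i - q * z i) * w i = 0 := by
    simp only [sub_mul, Finset.sum_sub_distrib, mul_assoc, ← Finset.mul_sum]
    linear_combination (p : ℝ) * hv0 - q * hu0
  have hwS (i) : |(w i : ℝ)| ≤ n * S := by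
    rcases eq_or_ne i j with rfl | hi
    · have h := abs_mul_le_of_abs_sum_le hS.le hj (fun l hl => (hwi l hl).le)
        (R := 0) (by rw [hsum, abs_zero])
      exact le_of_mul_le_mul_right (by linarith) (abs_pos.2 hj0)
    · exact (hwi i hi).le.trans (by nlinarith)
  refine ⟨w₀, w, hw, fun i => (hwS i).trans ?_, ?_⟩
  · gcongr; nlinarith
  · have hE0 : 0 ≤ E := (abs_nonneg _).trans (hE j)
    have h : (q : ℝ) * |∑ i, θ i * w i - w₀| ≤ n ^ 2 * S * E := by
      rw [← abs_of_pos hq', ← abs_mul, mul_form_eq_sum_error θ q y w₀ w hv0]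
      calc |∑ i, (θ i * q - y i) * w i| ≤ ∑ i, |(θ i * q - y i) * w i| :=
            Finset.abs_sum_le_sum_abs _ _
        _ ≤ ∑ _i : Fin n, E * (n * S) := Finset.sum_le_sum fun i _ => by
            rw [abs_mul]
            exact mul_le_mul (hE i) (hwS i) (abs_nonneg _) hE0
        _ = _ := by simp; ring
    rw [← one_div, le_div_iff₀ ht]
    refine le_of_mul_le_mul_left ?_ hq'
    calc _ = (q : ℝ) * |∑ i, θ i * w i - w₀| * t := by ring
      _ ≤ n ^ 2 * S * E * t := by gcongr
      _ ≤ _ := by linarith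

/-- The smallest denominator `q` of quality `C * t ^ (-γ)`, together with a vector `(p, z)` that is
not parallel to `(q, y)` and spans with it a lattice of small covolume. -/
theorem exists_approx_with_companion {n : ℕ} (hn : 0 < n) (θ : Fin n → ℝ) {γ C : ℝ} (hγ0 : 0 ≤ γ)
    (hγ1 : γ ≤ 1) (hC : 1 ≤ C)
    (h : ∀ t : ℝ, 1 ≤ t → ∃ (x : ℤ) (y : Fin n → ℤ), x ≠ 0 ∧ |(x : ℝ)| ≤ t ∧
      ∀ i, |θ i * (x : ℝ) - (y i : ℝ)| ≤ C * t ^ (-γ)) {t : ℝ} (ht : 1 ≤ t) :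
    ∃ (q : ℤ) (y : Fin n → ℤ) (p : ℤ) (z : Fin n → ℤ), 0 < q ∧ (q : ℝ) ≤ t ∧
      (∀ i, |θ i * q - y i| ≤ C * t ^ (-γ)) ∧ (∃ i, (p : ℝ) * y i - q * z i ≠ 0) ∧
      ∀ i, |(p : ℝ) * y i - q * z i| ≤ 4 * C * (q : ℝ) ^ (1 - γ) := by
  have hnat (t : ℝ) (ht : 1 ≤ t) : ∃ q : ℕ, 0 < q ∧ (q : ℝ) ≤ t ∧
      ∀ i, |θ i * q - round (θ i * q)| ≤ C * t ^ (-γ) := by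
    obtain ⟨x, y, hx, hxt, hy⟩ := h t ht
    refine ⟨x.natAbs, Int.natAbs_pos.2 hx, by rwa [Nat.cast_natAbs, Int.cast_abs], fun i => ?_⟩
    rw [Nat.cast_natAbs, Int.cast_abs]
    rcases abs_choice (x : ℝ) with h | h <;> rw [h]
    · exact (round_le _ (y i)).trans (hy i)
    · refine (round_le _ (-y i)).trans (le_trans (le_of_eq ?_) (hy i))
      rw [← abs_neg]; push_cast; congr 1; ring
  have hex : ∃ q : ℕ, 0 < q ∧ ∀ i, |θ i * q - round (θ i * q)| ≤ C * t ^ (-γ) :=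
    let ⟨q, h1, _, h2⟩ := hnat t ht
    ⟨q, h1, h2⟩
  classical
  set q := Nat.find hex with hqdef
  obtain ⟨hq0, hqE⟩ := Nat.find_spec hex
  have hqt : (q : ℝ) ≤ t := by
    obtain ⟨r, h1, h2, h3⟩ := hnat t ht
    exact le_trans (by exact_mod_cast Nat.find_min' hex ⟨h1, h3⟩) h2
  rw [← hqdef] at hq0 hqE
  have hqR : (0 : ℝ) < q := by exact_mod_cast hq0
  rcases (Nat.succ_le_iff.2 hq0).eq_or_lt with hq1 | hq1
  · refine ⟨q, fun i => round (θ i * q), 0, Pi.single ⟨0, hn⟩ 1, by exact_mod_cast hq0,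
      by exact_mod_cast hqt, by exact_mod_cast hqE, ⟨⟨0, hn⟩, by simp [hq0.ne']⟩, fun i => ?_⟩
    rw [← hq1]
    simp only [Pi.single_apply]
    split_ifs <;> simp <;> linarith
  · have hq2 : (2 : ℝ) ≤ q := by exact_mod_cast hq1
    obtain ⟨p, hp0, hpq, hpE⟩ := hnat (q - 1) (by linarith)
    have hpR : (0 : ℝ) < p := by exact_mod_cast hp0
    have hlt : p < q := by
      have : (p : ℝ) < q := by linarith
      exact_mod_cast this
    have hmin := Nat.find_min hex hlt
    refine ⟨q, fun i => round (θ i * q), p, fun i => round (θ i * p), by exact_mod_cast hq0,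
      by exact_mod_cast hqt, by exact_mod_cast hqE, ?_, fun i => ?_⟩
    · by_contra! hall
      refine hmin ⟨hp0, fun i => le_trans ?_ (hqE i)⟩
      have hi := hall i
      push_cast at hi
      have : (q : ℝ) * (θ i * p - round (θ i * p)) = p * (θ i * q - round (θ i * q)) := by
        linear_combination hi
      have := congrArg abs this
      rw [abs_mul, abs_mul, abs_of_pos hqR, abs_of_pos hpR] at this
      have hle : (p : ℝ) ≤ q := by exact_mod_cast hlt.le
      refine le_of_mul_le_mul_left (this.trans_le ?_) hqR
      gcongr
    · have hhalf : ((q : ℝ) - 1) ^ (-γ) ≤ 2 * (q : ℝ) ^ (-γ) := by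
        calc ((q : ℝ) - 1) ^ (-γ) ≤ ((q : ℝ) / 2) ^ (-γ) :=
              Real.rpow_le_rpow_of_nonpos (by positivity) (by linarith) (by linarith)
          _ = (2 : ℝ) ^ γ * (q : ℝ) ^ (-γ) := by
              rw [Real.div_rpow hqR.le zero_le_two, Real.rpow_neg zero_le_two, div_inv_eq_mul,
                mul_comm]
          _ ≤ 2 * (q : ℝ) ^ (-γ) := by
              gcongr
              simpa using Real.rpow_le_rpow_of_exponent_le one_le_two hγ1
      have hqmono : (q : ℝ) ≥ p := by exact_mod_cast hlt.le
      have htq : t ^ (-γ) ≤ (q : ℝ) ^ (-γ) :=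
        Real.rpow_le_rpow_of_nonpos hqR hqt (by linarith)
      have hX : 0 < (q : ℝ) ^ (-γ) := Real.rpow_pos_of_pos hqR _
      have h1 : |θ i * q - round (θ i * q)| ≤ 2 * C * (q : ℝ) ^ (-γ) :=
        (hqE i).trans (by nlinarith)
      have h2 : |θ i * p - round (θ i * p)| ≤ 2 * C * (q : ℝ) ^ (-γ) :=
        (hpE i).trans (by nlinarith)
      push_cast
      have hid : (p : ℝ) * round (θ i * q) - q * round (θ i * p) =
          q * (θ i * p - round (θ i * p)) - p * (θ i * q - round (θ i * q)) := by ring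
      rw [hid, sub_eq_add_neg 1 γ, Real.rpow_add hqR, Real.rpow_one]
      refine (abs_sub _ _).trans ?_
      rw [abs_mul, abs_mul, abs_of_pos hqR, abs_of_pos hpR]
      calc _ ≤ (q : ℝ) * (2 * C * (q : ℝ) ^ (-γ)) + q * (2 * C * (q : ℝ) ^ (-γ)) := by gcongr
        _ = _ := by ring

theorem exists_small_form_of_uniform_exponent {n : ℕ} (hn : 0 < n) (θ : Fin n → ℝ) {γ C : ℝ}
    (hγ0 : 0 ≤ γ) (hγ1 : γ ≤ 1) (hC : 1 ≤ C)
    (h : ∀ t : ℝ, 1 ≤ t → ∃ (x : ℤ) (y : Fin n → ℤ), x ≠ 0 ∧ |(x : ℝ)| ≤ t ∧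
      ∀ i, |θ i * (x : ℝ) - (y i : ℝ)| ≤ C * t ^ (-γ)) {S t : ℝ} (hS : 0 < S) (ht : 1 < t)
    (hSt : 4 * C * t ^ (1 - γ) < S ^ (n - 1)) :
    ∃ (w : Fin n → ℤ) (w₀ : ℤ), w ≠ 0 ∧ (∀ i, |(w i : ℝ)| ≤ 2 * n ^ 2 * S) ∧
      |∑ i, θ i * w i - w₀| ≤ t⁻¹ := by
  have ht0 : 0 < t := by linarith
  have : Nonempty (Fin n) := ⟨⟨0, hn⟩⟩
  obtain ⟨q, y, p, z, hq, hqt, hqE, ⟨i₀, hi₀⟩, hD⟩ :=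
    exists_approx_with_companion hn θ hγ0 hγ1 hC h ht.le
  have hq' : (0 : ℝ) < q := by exact_mod_cast hq
  obtain ⟨j, hj⟩ := Finite.exists_max fun i => |θ i * q - y i|
  obtain ⟨k, hk⟩ := Finite.exists_max fun i => |(p : ℝ) * y i - q * z i|
  have key : ∃ (w₀ : ℤ) (w : Fin n → ℤ), (w = 0 → w₀ ≠ 0) ∧
      (∀ i, |(w i : ℝ)| ≤ 2 * n ^ 2 * S) ∧ |∑ i, θ i * w i - w₀| ≤ t⁻¹ := by
    rcases lt_or_ge (q : ℝ) (n ^ 2 * S * |θ j * q - y j| * t) with hlt | hge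
    · refine exists_small_form_of_large_error θ hq y hj hS ht0 ((hqE j).trans_lt ?_) hlt
      have hpos : 0 < t ^ (1 - γ) := Real.rpow_pos_of_pos ht0 _
      have : t ^ (-γ) = t⁻¹ * t ^ (1 - γ) := by
        rw [sub_eq_add_neg, Real.rpow_add ht0, Real.rpow_one, inv_mul_cancel_left₀ ht0.ne']
      rw [this, mul_left_comm]
      gcongr
      nlinarith
    · refine exists_small_form_of_small_error θ hq y z hk ?_ hS ht0 hj ?_ hge
      · exact abs_pos.1 ((abs_pos.2 hi₀).trans_le (hk i₀))
      · refine ((hD k).trans ?_).trans_lt hSt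
        gcongr
  obtain ⟨w₀, w, hw, hwS, hL⟩ := key
  refine ⟨w, w₀, fun hw0 => hw hw0 ?_, hwS, hL⟩
  have : |(w₀ : ℝ)| < 1 := by
    have := hL.trans_lt (inv_lt_one_of_one_lt₀ ht)
    simpa [hw0] using this
  exact Int.abs_lt_one_iff.1 (by exact_mod_cast this)

/-- Uniform approximation for large `t` extends to all `t ≥ 1` at the cost of a constant, and the
exponent may be lowered. -/
theorem exists_const_forall_one_le {n : ℕ} (θ : Fin n → ℝ) {γ γ' : ℝ} (hγ' : 0 ≤ γ')
    (hle : γ' ≤ max γ 0)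
    (hγ : ∃ T : ℝ, ∀ t : ℝ, T ≤ t → ∃ (x : ℤ) (y : Fin n → ℤ),
      x ≠ 0 ∧ |(x : ℝ)| ≤ t ∧ ∀ i, |θ i * (x : ℝ) - (y i : ℝ)| ≤ t ^ (-γ)) :
    ∃ C : ℝ, 1 ≤ C ∧ ∀ t : ℝ, 1 ≤ t → ∃ (x : ℤ) (y : Fin n → ℤ), x ≠ 0 ∧ |(x : ℝ)| ≤ t ∧
      ∀ i, |θ i * (x : ℝ) - (y i : ℝ)| ≤ C * t ^ (-γ') := by
  obtain ⟨T, hT⟩ := hγ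
  have hC : 1 ≤ (max T 1) ^ γ' := Real.one_le_rpow (le_max_right _ _) hγ'
  refine ⟨(max T 1) ^ γ', hC, fun t ht => ?_⟩
  have ht0 : 0 < t := by linarith
  by_cases hcase : T ≤ t ∧ γ' ≤ γ
  · obtain ⟨x, y, hx, hxt, hy⟩ := hT t hcase.1
    refine ⟨x, y, hx, hxt, fun i => (hy i).trans ?_⟩
    have h1 : t ^ (-γ) ≤ t ^ (-γ') := Real.rpow_le_rpow_of_exponent_le ht (by linarith [hcase.2])
    have h2 : 0 < t ^ (-γ') := Real.rpow_pos_of_pos ht0 _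
    nlinarith
  · refine ⟨1, fun i => round (θ i), one_ne_zero, by simpa using ht, fun i => ?_⟩
    have hround : |θ i * ((1 : ℤ) : ℝ) - round (θ i)| ≤ 1 := by
      simpa using (abs_sub_round (θ i)).trans (by norm_num)
    refine hround.trans ?_
    rw [Real.rpow_neg ht0.le, ← div_eq_mul_inv, one_le_div (Real.rpow_pos_of_pos ht0 _)]
    rcases not_and_or.1 hcase with hTt | hgg
    · exact Real.rpow_le_rpow ht0.le (le_max_of_le_left (not_le.1 hTt).le) hγ'
    · have : γ' = 0 := by
        rcases le_max_iff.1 hle with h | h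
        · exact absurd h hgg
        · linarith
      simp [this]

theorem exists_exponents_in_range {m γ δ : ℝ} (hm : 1 ≤ m) (h : δ * (1 - γ) < m) :
    ∃ γ' δ' : ℝ, 0 ≤ γ' ∧ γ' ≤ 1 ∧ γ' ≤ max γ 0 ∧ 0 < δ' ∧ δ ≤ δ' ∧ δ' * (1 - γ') < m := by
  set η := 1 / (|δ| + 1) with hη
  have hδ1 : 0 < |δ| + 1 := by positivity
  have hη0 : 0 < η := by positivity
  have hη1 : η ≤ 1 := by rw [hη, div_le_one hδ1]; linarith [abs_nonneg δ]
  have hδη : |δ| * η < 1 := by rw [hη, mul_one_div, div_lt_one hδ1]; linarith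
  have hg : δ * (1 - min (max γ 0) (1 - η)) < m := by
    rcases le_total (max γ 0) (1 - η) with h1 | h1
    · rw [min_eq_left h1]
      rcases le_total γ 0 with h2 | h2
      · rw [max_eq_right h2]
        rcases le_total δ 0 with h3 | h3 <;> nlinarith
      · rwa [max_eq_left h2]
    · rw [min_eq_right h1]
      nlinarith [le_abs_self δ]
  have hγ0 : 0 ≤ min (max γ 0) (1 - η) := le_min (le_max_right _ _) (by linarith)
  have hγ1 : min (max γ 0) (1 - η) ≤ 1 := (min_le_right _ _).trans (by linarith)
  refine ⟨min (max γ 0) (1 - η), max δ (1 / 2), hγ0, hγ1, min_le_left _ _,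
    lt_max_of_lt_right (by norm_num), le_max_left _ _, ?_⟩
  rcases le_total δ (1 / 2) with h1 | h1
  · rw [max_eq_right h1]; linarith
  · rwa [max_eq_left h1]


/-- Transference inequality for uniform exponents (German, 2012):
ω̂(L_Θ) ≥ (n-1)/(1 - ω̂(Θ)) for Θ ∈ ℝⁿ \ ℚⁿ (with the convention that the
right-hand side is +∞ when ω̂(Θ) = 1).  Since the sets of admissible uniform
exponents are downward closed, this is expressed pointwise: if γ is an
admissible uniform exponent for simultaneous approximation of Θ and
δ·(1 - γ) < n - 1, then δ is an admissible uniform exponent for L_Θ. -/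
theorem uniform_transference (n : ℕ) (hn : 2 ≤ n) (θ : Fin n → ℝ)
    (hθ : ∃ i, Irrational (θ i)) (γ δ : ℝ)
    (hγ : ∃ T : ℝ, ∀ t : ℝ, T ≤ t → ∃ (x : ℤ) (y : Fin n → ℤ),
      x ≠ 0 ∧ |(x : ℝ)| ≤ t ∧ ∀ i, |θ i * (x : ℝ) - (y i : ℝ)| ≤ t ^ (-γ))
    (hδ : δ * (1 - γ) < (n : ℝ) - 1) :
    ∃ S : ℝ, ∀ s : ℝ, S ≤ s → ∃ (x : Fin n → ℤ) (y : ℤ),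
      x ≠ 0 ∧ (∀ i, |(x i : ℝ)| ≤ s) ∧
      |∑ i, θ i * (x i : ℝ) - (y : ℝ)| ≤ s ^ (-δ) := by
  have hn' : (2 : ℝ) ≤ n := by exact_mod_cast hn
  obtain ⟨γ', δ', hγ0, hγ1, hγγ, hδ0, hδδ, hlt⟩ :=
    exists_exponents_in_range (by linarith) hδ
  obtain ⟨C, hC, hunif⟩ := exists_const_forall_one_le θ hγ0 hγγ hγ
  have htend := tendsto_rpow_atTop (sub_pos.2 hlt)
  obtain ⟨S₀, hS₀⟩ := Filter.eventually_atTop.1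
    ((htend.eventually_gt_atTop (4 * C * (2 * n ^ 2) ^ (n - 1))).and (Filter.eventually_gt_atTop 1))
  refine ⟨S₀, fun s hs => ?_⟩
  obtain ⟨hbig, hs1⟩ := hS₀ s hs
  have hs0 : 0 < s := by linarith
  obtain ⟨w, w₀, hw, hws, hL⟩ := exists_small_form_of_uniform_exponent (by omega) θ hγ0 hγ1 hC
    hunif (S := s / (2 * n ^ 2)) (t := s ^ δ') (by positivity) (Real.one_lt_rpow hs1 hδ0) (by
      rw [← Real.rpow_mul hs0.le, div_pow, lt_div_iff₀ (by positivity)]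
      rw [Real.rpow_sub hs0, lt_div_iff₀ (Real.rpow_pos_of_pos hs0 _)] at hbig
      calc _ = 4 * C * (2 * n ^ 2) ^ (n - 1) * s ^ (δ' * (1 - γ')) := by ring
        _ < s ^ ((n : ℝ) - 1) := hbig
        _ = s ^ (n - 1) := by
          rw [← Real.rpow_natCast s (n - 1), Nat.cast_sub (by omega), Nat.cast_one])
  refine ⟨w, w₀, hw, fun i => (hws i).trans_eq (by field_simp), hL.trans ?_⟩
  rw [← Real.rpow_neg hs0.le]
  exact Real.rpow_le_rpow_of_exponent_le hs1.le (by linarith)
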